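/- arXiv:1303.0511 — 3 statements merged into one kernel-verified Lean document; each statement's English description precedes it below -/
import Mathlib

section
/- Let n ≥ 1 be an integer and let α be a real number with -π/2 < α < π/2. Let g be analytic in the open unit disk 𝕌 and suppose A := inf_{z ∈ 𝕌} { Re(g(z))·cos α − |Im(g(z))·sin α| } > 0. If p ∈ 𝓗[1,n] satisfies p ≢ 1 and Re(p(z) + g(z)·z·p'(z)) > (1/(2nA))·((cos α + 2nA)·sin²α − n²A²·cos α) for all z ∈ 𝕌, then |arg(p(z))| < π/2 − |α| for all z ∈ 𝕌. -/
open Metric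

open Filter Topology Asymptotics in
/-- Schwarz type estimate for functions with positive real part on a disk. -/
theorem aux_schwarz (P : ℂ → ℂ) (a : ℂ) (ha : 0 < a.re) (m : ℕ) (r : ℝ) (hr : 0 < r)
    (hP : DifferentiableOn ℂ P (ball (0 : ℂ) r)) (hP0 : P 0 = a)
    (ho : (fun z => P z - a) =o[𝓝 0] fun z : ℂ => ‖z‖ ^ m)
    (hpos : ∀ z ∈ ball (0 : ℂ) r, 0 < (P z).re) (z : ℂ) (hz : z ∈ ball (0 : ℂ) r) :
    ‖P z - a‖ ≤ (‖z‖ / r) ^ (m + 1) * ‖P z + (starRingEnd ℂ) a‖ := by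
  have hne : ∀ z ∈ ball (0 : ℂ) r, P z + (starRingEnd ℂ) a ≠ 0 := by
    intro z hz h
    have h1 := congrArg Complex.re h
    have := hpos z hz
    simp at h1
    linarith
  set w : ℂ → ℂ := fun z => (P z - a) / (P z + (starRingEnd ℂ) a) with hw
  have hw0 : w 0 = 0 := by simp [hw, hP0]
  have hwd : DifferentiableOn ℂ w (ball (0 : ℂ) r) :=
    (hP.sub_const a).div (hP.add_const _) hne
  have hmaps : Set.MapsTo w (ball (0 : ℂ) r) (closedBall (w 0) 1) := by
    intro z hz
    rw [hw0, mem_closedBall_zero_iff]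
    simp only [hw]
    rw [norm_div]
    refine div_le_one_of_le₀ ?_ (norm_nonneg _)
    rw [← sq_le_sq₀ (norm_nonneg _) (norm_nonneg _), ← Complex.normSq_eq_norm_sq,
      ← Complex.normSq_eq_norm_sq, Complex.normSq_apply, Complex.normSq_apply]
    have := hpos z hz
    simp
    nlinarith
  have hcont : ContinuousAt P 0 := hP.continuousOn.continuousAt (ball_mem_nhds _ hr)
  have hO : (fun z => (P z + (starRingEnd ℂ) a)⁻¹) =O[𝓝 0] fun _ : ℂ => (1 : ℝ) := by
    have : ContinuousAt (fun z => (P z + (starRingEnd ℂ) a)⁻¹) 0 :=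
      (hcont.add continuousAt_const).inv₀ (hne 0 (mem_ball_self hr))
    exact this.tendsto.isBigO_one ℝ
  have hwo : (fun z => w z - w 0) =o[𝓝 0] fun z : ℂ => ‖z - 0‖ ^ m := by
    have := ho.mul_isBigO hO
    simpa [hw, div_eq_mul_inv, hP0] using this
  have := Complex.dist_le_mul_div_pow_of_mapsTo_ball_of_isLittleO hwd hmaps hwo hz
  rw [hw0, dist_zero_right, dist_zero_right, one_mul] at this
  simp only [hw] at this
  rw [norm_div, div_le_iff₀ (norm_pos_iff.2 (hne z hz))] at this
  exact this

open Filter Topology Asymptotics in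
/-- Miller-Mocanu type lemma at the first exit point from the right half-plane. -/
theorem aux_exit (P : ℂ → ℂ) (a : ℂ) (ha : 0 < a.re) (m : ℕ)
    (hP : DifferentiableOn ℂ P (ball (0 : ℂ) 1)) (hP0 : P 0 = a)
    (ho : (fun z => P z - a) =o[𝓝 0] fun z : ℂ => ‖z‖ ^ m)
    (z₁ : ℂ) (hz₁ : z₁ ∈ ball (0 : ℂ) 1) (hz₁P : (P z₁).re ≤ 0) :
    ∃ z ∈ ball (0 : ℂ) 1, (P z).re = 0 ∧ (z * deriv P z).im = 0 ∧
      (m + 1) * ‖P z + (starRingEnd ℂ) a‖ ^ 2 + 2 * a.re * (z * deriv P z).re ≤ 0 := by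
  have hsub : closedBall (0 : ℂ) ‖z₁‖ ⊆ ball 0 1 :=
    closedBall_subset_ball (by simpa using hz₁)
  have hcl : IsClosed (closedBall (0 : ℂ) ‖z₁‖ ∩ (fun z => (P z).re) ⁻¹' Set.Iic 0) :=
    (Complex.continuous_re.comp_continuousOn (hP.continuousOn.mono hsub)).preimage_isClosed_of_isClosed
      isClosed_closedBall isClosed_Iic
  have hK : IsCompact (closedBall (0 : ℂ) ‖z₁‖ ∩ (fun z => (P z).re) ⁻¹' Set.Iic 0) :=
    (isCompact_closedBall (0 : ℂ) ‖z₁‖).of_isClosed_subset hcl Set.inter_subset_left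
  obtain ⟨z, hzK, hmin⟩ := hK.exists_isMinOn ⟨z₁, by simp, hz₁P⟩ continuous_norm.continuousOn
  have hzb : z ∈ ball (0 : ℂ) 1 := hsub hzK.1
  have hz1 : ‖z‖ < 1 := by simpa using hzb
  have hzle : ‖z‖ ≤ ‖z₁‖ := by simpa using hzK.1
  have hzre : (P z).re ≤ 0 := hzK.2
  have hpos : ∀ y ∈ ball (0 : ℂ) ‖z‖, 0 < (P y).re := by
    intro y hy
    have hy' : ‖y‖ < ‖z‖ := by simpa using hy
    by_contra! h
    have := hmin (a := y) ⟨by simpa using hy'.le.trans hzle, h⟩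
    simp only [Set.mem_ofPred_eq] at this
    linarith
  have hz0 : z ≠ 0 := by
    rintro rfl
    rw [hP0] at hzre
    linarith
  have hr : 0 < ‖z‖ := norm_pos_iff.2 hz0
  have hPat : ∀ y ∈ ball (0 : ℂ) 1, HasDerivAt P (deriv P y) y := fun y hy =>
    (hP.differentiableAt (isOpen_ball.mem_nhds hy)).hasDerivAt
  -- nonnegativity on the circle
  have hnonneg : ∀ y : ℂ, ‖y‖ = ‖z‖ → 0 ≤ (P y).re := by
    intro y hy
    have hyb : y ∈ ball (0 : ℂ) 1 := by simpa [hy] using hz1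
    have hc : ContinuousAt (fun t : ℝ => (P (t * y)).re) 1 := by
      have h1 : ContinuousAt P (((1 : ℝ) : ℂ) * y) := by
        simpa using (hPat y hyb).continuousAt
      exact Complex.continuous_re.continuousAt.comp
        (ContinuousAt.comp (f := fun t : ℝ => (t : ℂ) * y) h1 (by fun_prop))
    have ht : Tendsto (fun t : ℝ => (P (t * y)).re) (𝓝[<] 1) (𝓝 (P y).re) := by
      have := hc.tendsto.mono_left (nhdsWithin_le_nhds (s := Set.Iio 1))
      simpa using this
    refine ge_of_tendsto ht ?_
    filter_upwards [Ioo_mem_nhdsLT (show (0 : ℝ) < 1 by norm_num)] with t ht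
    refine (hpos _ ?_).le
    rw [mem_ball_zero_iff, norm_mul, hy, Complex.norm_real, Real.norm_of_nonneg ht.1.le]
    nlinarith [ht.2]
  have hre0 : (P z).re = 0 := le_antisymm hzre (hnonneg z rfl)
  refine ⟨z, hzb, hre0, ?_, ?_⟩
  · -- tangential
    have h1 : HasDerivAt (fun t : ℝ => Complex.exp (t * Complex.I) * z) (Complex.I * z) 0 := by
      have h2 : HasDerivAt (fun t : ℂ => Complex.exp (t * Complex.I) * z) (Complex.I * z)
          ((0 : ℝ) : ℂ) := by
        have := (((hasDerivAt_id ((0 : ℝ) : ℂ)).mul_const Complex.I).cexp).mul_const z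
        simpa using this
      exact h2.comp_ofReal
    have h3 : HasDerivAt P (deriv P z) (Complex.exp (((0 : ℝ) : ℂ) * Complex.I) * z) := by
      simpa using hPat z hzb
    have h4 := h3.comp_of_eq (0 : ℝ) h1 rfl
    have h5 : HasDerivAt (fun t : ℝ => (P (Complex.exp (t * Complex.I) * z)).re)
        (deriv P z * (Complex.I * z)).re 0 :=
      (Complex.reCLM.hasFDerivAt.comp_hasDerivAt (0 : ℝ) h4)
    have h6 : IsLocalMin (fun t : ℝ => (P (Complex.exp (t * Complex.I) * z)).re) 0 := by
      refine Eventually.of_forall fun t => ?_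
      simp only [Complex.ofReal_zero, zero_mul, Complex.exp_zero, one_mul, hre0]
      exact hnonneg _ (by rw [norm_mul, Complex.norm_exp_ofReal_mul_I, one_mul])
    have h7 := h6.hasDerivAt_eq_zero h5
    simp at h7 ⊢
    linarith
  · -- radial
    have h1 : HasDerivAt (fun t : ℝ => (t : ℂ) * z) z 1 := by
      have h2 : HasDerivAt (fun t : ℂ => t * z) z ((1 : ℝ) : ℂ) := by
        simpa using (hasDerivAt_id ((1 : ℝ) : ℂ)).mul_const z
      exact h2.comp_ofReal
    have h3 : HasDerivAt P (deriv P z) (((1 : ℝ) : ℂ) * z) := by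
      simpa using hPat z hzb
    have h4 := h3.comp_of_eq (1 : ℝ) h1 rfl
    set c := deriv P z * z with hcdef
    have hR : HasDerivAt (fun t : ℝ => (P (t * z)).re) c.re 1 :=
      (Complex.reCLM.hasFDerivAt.comp_hasDerivAt (1 : ℝ) h4)
    have hI : HasDerivAt (fun t : ℝ => (P (t * z)).im) c.im 1 :=
      (Complex.imCLM.hasFDerivAt.comp_hasDerivAt (1 : ℝ) h4)
    have hT : HasDerivAt (fun t : ℝ => t ^ (2 * (m + 1))) (2 * (m + 1)) 1 := by
      simpa using hasDerivAt_pow (2 * (m + 1)) (1 : ℝ)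
    have hH := (hT.mul (((hR.add_const a.re).pow 2).add ((hI.sub_const a.im).pow 2))).sub
      (((hR.sub_const a.re).pow 2).add ((hI.sub_const a.im).pow 2))
    have hle : ∀ t ∈ Set.Ioo (0 : ℝ) 1, 0 ≤ t ^ (2 * (m + 1)) *
        (((P (t * z)).re + a.re) ^ 2 + ((P (t * z)).im - a.im) ^ 2) -
        (((P (t * z)).re - a.re) ^ 2 + ((P (t * z)).im - a.im) ^ 2) := by
      intro t ht
      have hn : ‖(t : ℂ) * z‖ = t * ‖z‖ := by
        rw [norm_mul, Complex.norm_real, Real.norm_of_nonneg ht.1.le]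
      have hm : (t : ℂ) * z ∈ ball (0 : ℂ) ‖z‖ := by
        rw [mem_ball_zero_iff, hn]
        nlinarith [ht.2]
      have := aux_schwarz P a ha m ‖z‖ hr (hP.mono (ball_subset_ball hz1.le)) hP0 ho hpos _ hm
      rw [hn, mul_div_assoc, div_self hr.ne', mul_one] at this
      have h2 := pow_le_pow_left₀ (norm_nonneg _) this 2
      rw [mul_pow, ← Complex.normSq_eq_norm_sq,
        ← Complex.normSq_eq_norm_sq, Complex.normSq_apply, Complex.normSq_apply, ← pow_mul,
        mul_comm (m + 1) 2] at h2
      simp at h2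
      simp only [pow_two, sub_eq_add_neg] at h2 ⊢
      linarith
    have hd : 2 * (m + 1) * ((a.re) ^ 2 + ((P z).im - a.im) ^ 2) + 4 * a.re * c.re ≤ 0 := by
      by_contra! hcon
      have hH' := hH.hasDerivWithinAt (s := Set.Iio 1)
      rw [hasDerivWithinAt_iff_tendsto_slope' (by simp)] at hH'
      have := le_of_tendsto hH' (b := 0) (by
        filter_upwards [Ioo_mem_nhdsLT (show (0 : ℝ) < 1 by norm_num)] with t ht
        have h0 := hle t ht
        rw [slope_def_field]
        refine div_nonpos_of_nonneg_of_nonpos ?_ (by linarith [ht.2])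
        simp only [Pi.sub_apply, Pi.mul_apply, Pi.add_apply, Pi.pow_apply]
        simp [hre0]
        linarith)
      simp [hre0] at this
      nlinarith
    have hnorm : ‖P z + (starRingEnd ℂ) a‖ ^ 2 = (a.re) ^ 2 + ((P z).im - a.im) ^ 2 := by
      rw [← Complex.normSq_eq_norm_sq, Complex.normSq_apply]
      simp [hre0]
      ring
    rw [hnorm, mul_comm z, ← hcdef]
    linarith

open Filter Topology Asymptotics in
/-- A function whose first Taylor coefficients vanish is small near the origin. -/
theorem aux_littleO (p : ℂ → ℂ) (hp : DifferentiableOn ℂ p (ball (0 : ℂ) 1)) (hp0 : p 0 = 1)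
    (m : ℕ) (hpcoef : ∀ k : ℕ, 1 ≤ k → k < m + 1 → iteratedDeriv k p 0 = 0) :
    (fun z => p z - 1) =o[𝓝 0] fun z : ℂ => ‖z‖ ^ m := by
  have han : AnalyticAt ℂ p 0 := hp.analyticAt (ball_mem_nhds _ one_pos)
  have han' : AnalyticAt ℂ (fun z => p z - 1) 0 := han.sub analyticAt_const
  have hord : ((m + 1 : ℕ) : ℕ∞) ≤ analyticOrderAt (fun z => p z - 1) 0 := by
    rw [natCast_le_analyticOrderAt_iff_iteratedDeriv_eq_zero han']
    intro i hi
    rcases Nat.eq_zero_or_pos i with rfl | h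
    · simp [hp0]
    · have h0 := hpcoef i h hi
      obtain ⟨j, rfl⟩ : ∃ j, i = j + 1 := ⟨i - 1, by omega⟩
      rw [iteratedDeriv_succ'] at h0
      simp [iteratedDeriv_succ', h0]
  rw [natCast_le_analyticOrderAt han'] at hord
  obtain ⟨v, hv, hve⟩ := hord
  have hve' : (fun z => p z - 1) =ᶠ[𝓝 0] fun z => z ^ m * (z * v z) := by
    filter_upwards [hve] with z hz
    rw [hz]
    simp [pow_succ, mul_assoc]
  refine hve'.trans_isLittleO ?_
  have h1 : (fun z : ℂ => z * v z) =o[𝓝 0] fun _ : ℂ => (1 : ℝ) := by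
    rw [isLittleO_one_iff]
    have : ContinuousAt (fun z : ℂ => z * v z) 0 := continuousAt_id.mul hv.continuousAt
    simpa using this.tendsto
  have h2 : (fun z : ℂ => z ^ m) =O[𝓝 0] fun z : ℂ => ‖z‖ ^ m :=
    isBigO_of_le _ (by simp)
  simpa using h2.mul_isLittleO h1

/-- One half of the sector condition. -/
theorem aux_half
    (m : ℕ) (c s : ℝ) (hc : 0 < c) (hcs : c ^ 2 + s ^ 2 = 1)
    (g p : ℂ → ℂ)
    (hp : DifferentiableOn ℂ p (ball (0 : ℂ) 1))
    (hp0 : p 0 = 1)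
    (hpcoef : ∀ k : ℕ, 1 ≤ k → k < m + 1 → iteratedDeriv k p 0 = 0)
    (A : ℝ)
    (hA : ∀ z ∈ ball (0 : ℂ) 1, A ≤ (g z).re * c - |(g z).im * s|)
    (hApos : 0 < A)
    (hre : ∀ z ∈ ball (0 : ℂ) 1,
      (p z + g z * z * deriv p z).re >
        (1 / (2 * ((m : ℝ) + 1) * A)) *
          ((c + 2 * ((m : ℝ) + 1) * A) * s ^ 2 - ((m : ℝ) + 1) ^ 2 * A ^ 2 * c)) :
    ∀ z ∈ ball (0 : ℂ) 1, 0 < (p z).re * c - (p z).im * s := by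
  intro z₁ hz₁
  by_contra! hcon
  have ho := aux_littleO p hp hp0 m hpcoef
  set a : ℂ := ⟨c, s⟩ with ha
  obtain ⟨z, hz, h1, h2, h3⟩ := aux_exit (fun z => a * p z) a (by simpa [ha] using hc) m
    (hp.const_mul a) (by simp [hp0])
    (by simpa [mul_sub] using ho.const_mul_left a) z₁ hz₁ (by simp [ha]; linarith)
  have hder : deriv (fun z => a * p z) z = a * deriv p z :=
    deriv_const_mul _ (hp.differentiableAt (isOpen_ball.mem_nhds hz))
  rw [hder] at h2 h3
  have hrez := hre z hz
  have hAz := hA z hz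
  have hN : 0 < (m : ℝ) + 1 := by positivity
  generalize (m : ℝ) + 1 = N at *
  have e1 : g z * z * deriv p z = g z * (z * deriv p z) := by ring
  have e2 : z * (a * deriv p z) = a * (z * deriv p z) := by ring
  rw [e1] at hrez
  rw [e2] at h2 h3
  generalize z * deriv p z = D at *
  generalize p z = w at *
  generalize g z = G at *
  rw [← Complex.normSq_eq_norm_sq, Complex.normSq_apply] at h3
  obtain ⟨u, v⟩ := w
  obtain ⟨d, e⟩ := D
  obtain ⟨G₁, G₂⟩ := G
  simp [ha] at h1 h2 h3
  simp only [Complex.add_re, Complex.mul_re] at hrez hAz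
  obtain ⟨x, hx⟩ : ∃ x, x = c * v + s * u := ⟨_, rfl⟩
  obtain ⟨σ, hσ⟩ : ∃ σ, σ = c * d - s * e := ⟨_, rfl⟩
  have hu : u = s * x := by rw [hx]; linear_combination c * h1 - u * hcs
  have hd : d = c * σ := by rw [hσ]; linear_combination s * h2 - d * hcs
  have he : e = -(s * σ) := by rw [hσ]; linear_combination c * h2 - e * hcs
  have h3' : N * (c ^ 2 + (x - s) ^ 2) + 2 * c * σ ≤ 0 := by
    have : c * u - s * v = 0 := by linarith
    rw [this] at h3
    rw [hx, hσ]
    nlinarith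
  have hT : A ≤ G₁ * c + G₂ * s := by linarith [neg_abs_le (G₂ * s)]
  have hσ0 : σ ≤ 0 := by
    by_contra! h
    have : 0 ≤ N * (c ^ 2 + (x - s) ^ 2) := by positivity
    have := mul_pos hc h
    linarith
  have hval : u + (G₁ * d - G₂ * e) = s * x + σ * (G₁ * c + G₂ * s) := by
    rw [hu, hd, he]; ring
  have hle : s * x + σ * (G₁ * c + G₂ * s) ≤ s * x + σ * A := by
    linarith [mul_le_mul_of_nonpos_left hT hσ0]
  rw [hval, gt_iff_lt, one_div, inv_mul_lt_iff₀ (by positivity)] at hrez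
  have hlt : (c + 2 * N * A) * s ^ 2 - N ^ 2 * A ^ 2 * c < 2 * N * A * (s * x + σ * A) :=
    hrez.trans_le (mul_le_mul_of_nonneg_left hle (by positivity))
  have h4 := mul_lt_mul_of_pos_left hlt hc
  have h5 := mul_le_mul_of_nonneg_left h3' (show 0 ≤ N * A ^ 2 by positivity)
  nlinarith [sq_nonneg (c * s - N * A * (x - s))]


/-- **Theorem 1.**  Let `n ≥ 1`, `-π/2 < α < π/2`, `g` analytic in the unit disk with
`A = inf_{z∈𝕌} (Re g(z) cos α - |Im g(z) sin α|) > 0`.  If `p ∈ 𝓗[1,n]` satisfies `p ≢ 1` and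
`Re(p(z) + g(z) z p'(z)) > (1/(2nA))((cos α + 2nA) sin²α - n²A² cos α)` for all `z ∈ 𝕌`,
then `|arg p(z)| < π/2 - |α|` on `𝕌`. -/
theorem strongly_caratheodory_of_subordination
    (n : ℕ) (hn : 1 ≤ n) (α : ℝ) (hα₁ : -(Real.pi / 2) < α) (hα₂ : α < Real.pi / 2)
    (g p : ℂ → ℂ)
    (hg : DifferentiableOn ℂ g (ball (0 : ℂ) 1))
    (hp : DifferentiableOn ℂ p (ball (0 : ℂ) 1))
    (hp0 : p 0 = 1)
    (hpcoef : ∀ k : ℕ, 1 ≤ k → k < n → iteratedDeriv k p 0 = 0)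
    (A : ℝ)
    (hA : A = sInf ((fun z => (g z).re * Real.cos α - |(g z).im * Real.sin α|) ''
      ball (0 : ℂ) 1))
    (hApos : 0 < A)
    (hpne : ¬ ∀ z ∈ ball (0 : ℂ) 1, p z = 1)
    (hre : ∀ z ∈ ball (0 : ℂ) 1,
      (p z + g z * z * deriv p z).re >
        (1 / (2 * n * A)) *
          ((Real.cos α + 2 * n * A) * Real.sin α ^ 2 - (n : ℝ) ^ 2 * A ^ 2 * Real.cos α)) :
    ∀ z ∈ ball (0 : ℂ) 1, |(p z).arg| < Real.pi / 2 - |α| := by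
  obtain ⟨m, rfl⟩ : ∃ m, n = m + 1 := ⟨n - 1, by omega⟩
  have hc : 0 < Real.cos α := Real.cos_pos_of_mem_Ioo ⟨hα₁, hα₂⟩
  have hbdd : BddBelow ((fun z => (g z).re * Real.cos α - |(g z).im * Real.sin α|) ''
      ball (0 : ℂ) 1) := by
    by_contra h
    rw [Real.sInf_of_not_bddBelow h] at hA
    linarith
  have hAle : ∀ z ∈ ball (0 : ℂ) 1, A ≤ (g z).re * Real.cos α - |(g z).im * Real.sin α| := by
    intro z hz
    rw [hA]
    exact csInf_le hbdd ⟨z, hz, rfl⟩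
  push_cast at hre
  have k1 := aux_half m (Real.cos α) (Real.sin α) hc (by simp) g p hp hp0 hpcoef A hAle hApos hre
  have k2 := aux_half m (Real.cos α) (-Real.sin α) hc (by simp) g p hp hp0 hpcoef A
    (by simpa using hAle) hApos (by simpa using hre)
  intro z hz
  have q1 := k1 z hz
  have q2 := k2 z hz
  have hn0 : 0 < ‖p z‖ := by
    rw [norm_pos_iff]
    intro h
    rw [h] at q1
    simp at q1
  have hre' : (p z).re = ‖p z‖ * Real.cos (p z).arg := (Complex.norm_mul_cos_arg _).symm
  have him' : (p z).im = ‖p z‖ * Real.sin (p z).arg := (Complex.norm_mul_sin_arg _).symm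
  have hre_pos : 0 < (p z).re := by nlinarith
  have harg : |(p z).arg| < Real.pi / 2 := Complex.abs_arg_lt_pi_div_two_iff.2 (Or.inl hre_pos)
  rw [abs_lt] at harg
  rw [hre', him'] at q1 q2
  generalize (p z).arg = θ at *
  have c1 : 0 < Real.cos (θ + α) := by
    rw [Real.cos_add]
    exact pos_of_mul_pos_right (by linarith : 0 < ‖p z‖ *
      (Real.cos θ * Real.cos α - Real.sin θ * Real.sin α)) hn0.le
  have c2 : 0 < Real.cos (θ - α) := by
    rw [Real.cos_sub]
    exact pos_of_mul_pos_right (by linarith : 0 < ‖p z‖ *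
      (Real.cos θ * Real.cos α + Real.sin θ * Real.sin α)) hn0.le
  have key : ∀ t : ℝ, -Real.pi < t → t < Real.pi → 0 < Real.cos t → |t| < Real.pi / 2 := by
    intro t ht1 ht2 ht
    by_contra! h
    have h' : |t| ≤ Real.pi := abs_le.2 ⟨ht1.le, ht2.le⟩
    have := Real.cos_nonpos_of_pi_div_two_le_of_le h (by linarith [Real.pi_pos])
    rw [Real.cos_abs] at this
    linarith
  have d1 := abs_lt.1 (key (θ + α) (by linarith) (by linarith) c1)
  have d2 := abs_lt.1 (key (θ - α) (by linarith) (by linarith) c2)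
  rcases abs_cases θ with ⟨h, _⟩ | ⟨h, _⟩ <;> rcases abs_cases α with ⟨h', _⟩ | ⟨h', _⟩ <;>
    rw [h, h'] <;> linarith
end

section
/- Let n ≥ 1 be an integer and let μ be a real number with 0 < μ ≤ 1. Let g be analytic in the open unit disk 𝕌 and suppose A := inf_{z ∈ 𝕌} { Re(g(z))·sin(πμ/2) − |Im(g(z))·cos(πμ/2)| } > 0. If p ∈ 𝓗[1,n] satisfies p ≢ 1 and Re(p(z) + g(z)·z·p'(z)) > (1/(2nA))·((sin(πμ/2) + 2nA)·cos²(πμ/2) − n²A²·sin(πμ/2)) for all z ∈ 𝕌, then p ∈ 𝒮𝒯𝒫(μ), i.e., |arg(p(z))| < πμ/2 for all z ∈ 𝕌. -/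
open Metric

open Filter Topology Asymptotics ComplexConjugate

lemma deriv_left_nonpos {F : ℝ → ℝ} {F' : ℝ} (h : HasDerivAt F F' 1) (h1 : F 1 = 0)
    (hF : ∀ t : ℝ, 0 < t → t < 1 → 0 ≤ F t) : F' ≤ 0 := by
  have h2 := (hasDerivWithinAt_iff_tendsto_slope' (s := Set.Iio (1:ℝ)) (by simp)).1
    h.hasDerivWithinAt
  refine le_of_tendsto h2 ?_
  have : Set.Ioo (0:ℝ) 1 ∈ 𝓝[<] (1:ℝ) := Ioo_mem_nhdsLT (by norm_num)
  filter_upwards [this] with t ht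
  rw [slope_def_field, h1]
  exact div_nonpos_of_nonneg_of_nonpos (by simpa using hF t ht.1 ht.2) (by linarith [ht.2])

lemma schwarz_step {P : ℂ → ℂ} {a : ℂ} {m : ℕ} {r : ℝ}
    (hP : DifferentiableOn ℂ P (ball 0 r)) (hP0 : P 0 = a) (ha : 0 < a.re)
    (ho : (fun z => P z - a) =o[𝓝 0] (fun z => ‖z‖ ^ m))
    (hr : 0 < r) (hpos : ∀ z ∈ ball (0:ℂ) r, 0 < (P z).re) {z : ℂ} (hz : z ∈ ball (0:ℂ) r) :
    (1 - ((‖z‖ / r) ^ (m + 1)) ^ 2) * Complex.normSq (P z + conj a) ≤ 4 * a.re * (P z).re := by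
  have hne : ∀ z ∈ ball (0:ℂ) r, P z + conj a ≠ 0 := by
    intro z hz h
    have := congrArg Complex.re h
    simp at this
    linarith [hpos z hz]
  have key : ∀ w : ℂ, Complex.normSq (w + conj a) - Complex.normSq (w - a) = 4 * a.re * w.re := by
    intro w
    simp [Complex.normSq_apply]
    ring
  set w : ℂ → ℂ := fun z => (P z - a) / (P z + conj a) with hw
  have hw0 : w 0 = 0 := by simp [hw, hP0]
  have hd : DifferentiableOn ℂ w (ball 0 r) :=
    (hP.sub_const a).div (hP.add_const _) hne
  have hmaps : Set.MapsTo w (ball 0 r) (closedBall (w 0) 1) := by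
    intro z hz
    rw [hw0, mem_closedBall_zero_iff]
    simp only [hw, norm_div]
    apply div_le_one_of_le₀ _ (norm_nonneg _)
    rw [← abs_of_nonneg (norm_nonneg (P z - a)), ← abs_of_nonneg (norm_nonneg (P z + conj a)),
      ← sq_le_sq, ← Complex.normSq_eq_norm_sq, ← Complex.normSq_eq_norm_sq]
    have := key (P z)
    have := mul_pos ha (hpos z hz)
    linarith
  have hlo : (fun z => w z - w 0) =o[𝓝 0] (fun z => ‖z - 0‖ ^ m) := by
    simp only [hw0, sub_zero]
    have hc : ContinuousAt (fun z => (P z + conj a)⁻¹) 0 := by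
      have : ContinuousAt P 0 := hP.continuousOn.continuousAt (ball_mem_nhds _ hr)
      exact (this.add continuousAt_const).inv₀ (hne 0 (mem_ball_self hr))
    have hb : (fun z => (P z + conj a)⁻¹) =O[𝓝 0] (fun _ => (1:ℝ)) := hc.isBigO_one ℝ
    have := ho.mul_isBigO hb
    simpa [hw, div_eq_mul_inv] using this
  have := Complex.dist_le_mul_div_pow_of_mapsTo_ball_of_isLittleO hd hmaps hlo hz
  rw [hw0, dist_zero_right, dist_zero_right, one_mul] at this
  simp only [hw, norm_div] at this
  rw [div_le_iff₀ (norm_pos_iff.2 (hne z hz))] at this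
  have h2 := pow_le_pow_left₀ (norm_nonneg _) this 2
  rw [mul_pow, ← Complex.normSq_eq_norm_sq, ← Complex.normSq_eq_norm_sq] at h2
  have := key (P z)
  linarith

lemma boundary_point {P : ℂ → ℂ} {a : ℂ} {m : ℕ}
    (hP : DifferentiableOn ℂ P (ball 0 1)) (hP0 : P 0 = a) (ha : 0 < a.re)
    (ho : (fun z => P z - a) =o[𝓝 0] (fun z => ‖z‖ ^ m))
    {z₁ : ℂ} (hz₁ : z₁ ∈ ball (0:ℂ) 1) (hneg : (P z₁).re ≤ 0) :
    ∃ z ∈ ball (0:ℂ) 1, (P z).re = 0 ∧ (z * deriv P z).im = 0 ∧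
      2 * a.re * (z * deriv P z).re ≤ -((m:ℝ) + 1) * Complex.normSq (P z + conj a) := by
  have hsub : closedBall (0:ℂ) ‖z₁‖ ⊆ ball 0 1 :=
    closedBall_subset_ball (by simpa using hz₁)
  have hcont : ContinuousOn (fun z => (P z).re) (ball 0 1) :=
    Complex.continuous_re.comp_continuousOn hP.continuousOn
  have hK : IsCompact (closedBall (0:ℂ) ‖z₁‖ ∩ (fun z => (P z).re) ⁻¹' Set.Iic 0) := by
    apply (isCompact_closedBall (0:ℂ) ‖z₁‖).of_isClosed_subset _ Set.inter_subset_left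
    exact (hcont.mono hsub).preimage_isClosed_of_isClosed isClosed_closedBall isClosed_Iic
  obtain ⟨z₀, ⟨hz₀, hz₀'⟩, hmin⟩ := hK.exists_isMinOn ⟨z₁, by simp, hneg⟩
    (continuous_norm.continuousOn)
  have hz₀b := hsub hz₀
  simp only [Set.mem_preimage, Set.mem_Iic] at hz₀'
  have hz0ne : z₀ ≠ 0 := by
    rintro rfl
    rw [hP0] at hz₀'
    linarith
  have hr : 0 < ‖z₀‖ := norm_pos_iff.2 hz0ne
  have hpos : ∀ z ∈ ball (0:ℂ) ‖z₀‖, 0 < (P z).re := by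
    intro z hz
    by_contra hcon
    rw [mem_ball_zero_iff] at hz
    rw [mem_closedBall_zero_iff] at hz₀
    have : ‖z₀‖ ≤ ‖z‖ := hmin ⟨by simpa using hz.le.trans hz₀, not_lt.1 hcon⟩
    linarith
  have hsub0 : closedBall (0:ℂ) ‖z₀‖ ⊆ ball 0 1 :=
    closedBall_subset_ball (by simpa using hz₀b)
  have hnn : ∀ z ∈ closedBall (0:ℂ) ‖z₀‖, 0 ≤ (P z).re := by
    intro z hz
    rw [← closure_ball _ hr.ne'] at hz hsub0
    exact le_on_closure (fun x hx => (hpos x hx).le) continuousOn_const (hcont.mono hsub0) hz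
  have hre0 : (P z₀).re = 0 := le_antisymm hz₀' (hnn z₀ (by simp))
  have hder : HasDerivAt P (deriv P z₀) z₀ :=
    (hP.differentiableAt (isOpen_ball.mem_nhds hz₀b)).hasDerivAt
  refine ⟨z₀, hz₀b, hre0, ?_, ?_⟩
  · -- tangential
    have h1 : HasDerivAt (fun φ : ℂ => z₀ * Complex.exp (φ * Complex.I)) (z₀ * Complex.I)
        ((0:ℝ):ℂ) := by
      have := (((hasDerivAt_id ((0:ℝ):ℂ)).mul_const Complex.I).cexp).const_mul z₀
      simpa using this
    have h2 : HasDerivAt (fun φ : ℂ => P (z₀ * Complex.exp (φ * Complex.I)))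
        (deriv P z₀ * (z₀ * Complex.I)) ((0:ℝ):ℂ) := by
      refine HasDerivAt.comp ((0:ℝ):ℂ) (h₂ := P) ?_ h1
      simpa using hder
    have h3 := h2.real_of_complex
    have hmin : IsLocalMin
        (fun φ : ℝ => (P (z₀ * Complex.exp (φ * Complex.I))).re) 0 := by
      refine Eventually.of_forall fun φ => ?_
      simp only [Complex.ofReal_zero, zero_mul, Complex.exp_zero, mul_one, hre0]
      apply hnn
      simp [Complex.norm_exp_ofReal_mul_I]
    have h4 := hmin.hasDerivAt_eq_zero h3
    simp at h4 ⊢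
    linarith
  · have h1 : HasDerivAt (fun t : ℂ => P (t * z₀)) (deriv P z₀ * z₀) ((1:ℝ):ℂ) := by
      have h0 : HasDerivAt (fun t : ℂ => t * z₀) z₀ ((1:ℝ):ℂ) := by
        simpa using (hasDerivAt_id ((1:ℝ):ℂ)).mul_const z₀
      refine HasDerivAt.comp ((1:ℝ):ℂ) (h₂ := P) ?_ h0
      simpa using hder
    have h3 := h1.real_of_complex
    have h3' := (h1.const_mul (-Complex.I)).real_of_complex
    have hpw : HasDerivAt (fun t : ℝ => 1 - (t ^ (m + 1)) ^ 2) (-(2 * ((m:ℝ) + 1))) 1 := by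
      have := (((hasDerivAt_pow (m + 1) (1:ℝ)).pow 2).const_sub 1)
      refine this.congr_deriv ?_
      simp
    have hQ : ∃ Q', HasDerivAt (fun t : ℝ => Complex.normSq (P (t * z₀) + conj a)) Q' 1 := by
      refine ⟨_, HasDerivAt.congr_of_eventuallyEq
        (((h3.add_const a.re).pow 2).add ((h3'.sub_const a.im).pow 2)) ?_⟩
      refine Eventually.of_forall fun t => ?_
      simp [Complex.normSq_apply]
      ring
    obtain ⟨Q', hQ⟩ := hQ
    have hF := (h3.const_mul (4 * a.re)).sub (hpw.mul hQ)
    have := deriv_left_nonpos hF (by simp [hre0]) (by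
      intro t ht0 ht1
      have hmem : (t:ℂ) * z₀ ∈ ball (0:ℂ) ‖z₀‖ := by
        simp only [mem_ball_zero_iff, norm_mul, Complex.norm_real, Real.norm_eq_abs,
          abs_of_pos ht0]
        nlinarith
      have := schwarz_step (hP.mono (ball_subset_closedBall.trans hsub0)) hP0 ha ho hr hpos hmem
      have e : ‖(t:ℂ) * z₀‖ / ‖z₀‖ = t := by
        simp [abs_of_pos ht0, hr.ne']
      rw [e] at this
      simpa using this)
    simp only [Complex.ofReal_one, one_mul, one_pow, sub_self, zero_mul, add_zero] at this
    rw [mul_comm (deriv P z₀)] at this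
    linarith

lemma order_littleO {p : ℂ → ℂ} {m : ℕ} (hp : DifferentiableOn ℂ p (ball 0 1)) (hp0 : p 0 = 1)
    (hc : ∀ k : ℕ, 1 ≤ k → k < m + 1 → iteratedDeriv k p 0 = 0) :
    (fun z => p z - 1) =o[𝓝 0] (fun z => ‖z‖ ^ m) := by
  have han : AnalyticAt ℂ p 0 := hp.analyticAt (ball_mem_nhds _ one_pos)
  obtain ⟨F, hF, h⟩ := han.exists_eq_sum_add_pow_mul (m + 1)
  have e : (fun z => p z - 1) = fun z => z ^ (m + 1) * F z := by
    funext z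
    rw [h z, Finset.sum_eq_single 0]
    · simp [hp0]
    · intro k hk hk0
      rw [hc k (by omega) (by simpa using hk)]
      simp
    · simp
  rw [e]
  have h1 : (fun z : ℂ => z ^ m * (z * F z)) =o[𝓝 0] (fun z : ℂ => ‖z‖ ^ m * (1:ℝ)) := by
    refine IsBigO.mul_isLittleO ?_ ?_
    · exact IsBigO.of_bound 1 (Eventually.of_forall fun z => by simp)
    · rw [isLittleO_one_iff]
      have : ContinuousAt (fun z => z * F z) 0 := continuousAt_id.mul hF.continuousAt
      simpa [ContinuousAt] using this
  simpa [pow_succ, mul_assoc] using h1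

lemma half_plane {n : ℕ} (hn : 1 ≤ n) {s c e A : ℝ} (hs : 0 < s) (hsc : s ^ 2 + c ^ 2 = 1)
    (he : e ^ 2 = 1) {g p : ℂ → ℂ}
    (hp : DifferentiableOn ℂ p (ball (0 : ℂ) 1))
    (hp0 : p 0 = 1)
    (hpcoef : ∀ k : ℕ, 1 ≤ k → k < n → iteratedDeriv k p 0 = 0)
    (hApos : 0 < A)
    (hA : ∀ z ∈ ball (0:ℂ) 1, A ≤ (g z).re * s + e * (g z).im * c)
    (hre : ∀ z ∈ ball (0 : ℂ) 1,
      (p z + g z * z * deriv p z).re >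
        (1 / (2 * n * A)) * ((s + 2 * n * A) * c ^ 2 - (n : ℝ) ^ 2 * A ^ 2 * s)) :
    ∀ z ∈ ball (0 : ℂ) 1, 0 < (p z).re * s - e * (p z).im * c := by
  obtain ⟨m, rfl⟩ : ∃ m, n = m + 1 := ⟨n - 1, by omega⟩
  intro z₁ hz₁
  by_contra hcon
  set a : ℂ := ⟨s, e * c⟩ with ha
  have ho := (order_littleO hp hp0 hpcoef).const_mul_left a
  obtain ⟨z, hz, h1, h2, h3⟩ := boundary_point (P := fun z => a * p z) (a := a) (m := m)
    (hp.const_mul a) (by simp [hp0]) hs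
    (by simpa [mul_sub] using ho) hz₁ (by
      simp [ha]
      linarith)
  have hder : deriv (fun z => a * p z) z = a * deriv p z :=
    deriv_const_mul_field a
  rw [hder] at h2 h3
  have hN : (0:ℝ) < ((m + 1 : ℕ) : ℝ) := by positivity
  have hK := hre z hz
  have hG := hA z hz
  have hm : (m:ℝ) + 1 = ((m + 1 : ℕ) : ℝ) := by push_cast; ring
  rw [hm] at h3
  generalize ((m + 1 : ℕ) : ℝ) = N at *
  have hd : z * (a * deriv p z) = a * (z * deriv p z) := by ring
  have hd2 : g z * z * deriv p z = g z * (z * deriv p z) := by ring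
  rw [hd] at h2 h3
  rw [hd2] at hK
  generalize z * deriv p z = d at *
  generalize p z = w at *
  generalize g z = G at *
  obtain ⟨x, y⟩ := w
  obtain ⟨u, v⟩ := d
  obtain ⟨k, l⟩ := G
  simp [ha, Complex.normSq_apply] at h1 h2 h3 hK hG
  -- rho = s y + e c x, sigma = s u - e c v
  obtain ⟨ρ, hρ⟩ : ∃ ρ, ρ = s * y + e * c * x := ⟨_, rfl⟩
  obtain ⟨σ, hσ⟩ : ∃ σ, σ = s * u - e * c * v := ⟨_, rfl⟩
  have hec : (e * c) ^ 2 = c ^ 2 := by rw [mul_pow, he, one_mul]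
  have hx : x = e * c * ρ := by
    rw [hρ]; linear_combination s * h1 - x * hsc - x * hec
  have hu : u = s * σ := by
    rw [hσ]; linear_combination (e * c) * h2 - u * hsc - u * hec
  have hv : v = -(e * c) * σ := by
    rw [hσ]; linear_combination s * h2 - v * hsc - v * hec
  rw [← hσ, h1, ← hρ] at h3
  have hσ0 : σ ≤ 0 := by
    by_contra hh
    have : 0 < 2 * s * σ := by have := not_le.1 hh; positivity
    nlinarith [mul_pos hN (mul_pos hs hs), mul_nonneg hN.le (mul_self_nonneg (ρ + -(e * c)))]
  have hK2 : (A⁻¹ * (N⁻¹ * 2⁻¹)) * ((s + 2 * N * A) * c ^ 2 - N ^ 2 * A ^ 2 * s) <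
      e * c * ρ + σ * A := by
    refine hK.trans_le ?_
    rw [hx, hu, hv]
    nlinarith [mul_nonneg (neg_nonneg.2 hσ0) (sub_nonneg.2 hG)]
  have hK3 : s * ((s + 2 * N * A) * c ^ 2 - N ^ 2 * A ^ 2 * s) <
      2 * N * A * s * (e * c * ρ + σ * A) := by
    have := mul_lt_mul_of_pos_left hK2 (show 0 < 2 * N * A * s by positivity)
    refine lt_of_eq_of_lt ?_ this
    field_simp
  have h4 := mul_le_mul_of_nonneg_left h3 (show 0 ≤ N * A ^ 2 by positivity)
  have h5 : s * ((s + 2 * N * A) * c ^ 2 - N ^ 2 * A ^ 2 * s) -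
      (2 * N * A * s * (e * c * ρ) +
        N * A ^ 2 * (-(N * (s * s + (ρ + -(e * c)) * (ρ + -(e * c)))))) =
      (s * (e * c) - N * A * (ρ - e * c)) ^ 2 := by
    linear_combination (-s ^ 2 - 2 * N * A * s) * hec
  nlinarith [sq_nonneg (s * (e * c) - N * A * (ρ - e * c))]

/-- **Corollary 1.**  Version of Theorem 1 with `π μ/2 = π/2 - α`:  under the corresponding
hypotheses, `p` is a strongly Carathéodory function of order `μ`. -/
theorem strongly_caratheodory_order_mu_of_subordination
    (n : ℕ) (hn : 1 ≤ n) (μ : ℝ) (hμ₁ : 0 < μ) (hμ₂ : μ ≤ 1)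
    (g p : ℂ → ℂ)
    (hg : DifferentiableOn ℂ g (ball (0 : ℂ) 1))
    (hp : DifferentiableOn ℂ p (ball (0 : ℂ) 1))
    (hp0 : p 0 = 1)
    (hpcoef : ∀ k : ℕ, 1 ≤ k → k < n → iteratedDeriv k p 0 = 0)
    (A : ℝ)
    (hA : A = sInf ((fun z => (g z).re * Real.sin (Real.pi * μ / 2) -
      |(g z).im * Real.cos (Real.pi * μ / 2)|) '' ball (0 : ℂ) 1))
    (hApos : 0 < A)
    (hpne : ¬ ∀ z ∈ ball (0 : ℂ) 1, p z = 1)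
    (hre : ∀ z ∈ ball (0 : ℂ) 1,
      (p z + g z * z * deriv p z).re >
        (1 / (2 * n * A)) *
          ((Real.sin (Real.pi * μ / 2) + 2 * n * A) * Real.cos (Real.pi * μ / 2) ^ 2 -
            (n : ℝ) ^ 2 * A ^ 2 * Real.sin (Real.pi * μ / 2))) :
    ∀ z ∈ ball (0 : ℂ) 1, |(p z).arg| < Real.pi * μ / 2 := by
  set θ := Real.pi * μ / 2 with hθ
  have hπ := Real.pi_pos
  have hθ0 : 0 < θ := by positivity
  have hθ1 : θ ≤ Real.pi / 2 := by rw [hθ]; nlinarith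
  have hs : 0 < Real.sin θ := Real.sin_pos_of_pos_of_lt_pi hθ0 (by linarith)
  have hc : 0 ≤ Real.cos θ := Real.cos_nonneg_of_neg_pi_div_two_le_of_le (by linarith) hθ1
  have hsc := Real.sin_sq_add_cos_sq θ
  have hbdd : BddBelow ((fun z => (g z).re * Real.sin θ -
      |(g z).im * Real.cos θ|) '' ball (0 : ℂ) 1) := by
    by_contra h
    rw [Real.sInf_of_not_bddBelow h] at hA
    linarith
  have hAle : ∀ z ∈ ball (0:ℂ) 1, A ≤ (g z).re * Real.sin θ - |(g z).im * Real.cos θ| := by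
    intro z hz
    rw [hA]
    exact csInf_le hbdd ⟨z, hz, rfl⟩
  intro z hz
  have h1 := half_plane (e := 1) hn hs hsc (by norm_num) hp hp0 hpcoef hApos
    (fun z hz => by linarith [hAle z hz, neg_abs_le ((g z).im * Real.cos θ)]) hre z hz
  have h2 := half_plane (e := -1) hn hs hsc (by norm_num) hp hp0 hpcoef hApos
    (fun z hz => by linarith [hAle z hz, le_abs_self ((g z).im * Real.cos θ)]) hre z hz
  have hre0 : 0 < (p z).re := by
    have : 0 < (p z).re * Real.sin θ := by linarith
    exact pos_of_mul_pos_left this hs.le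
  have harg := abs_lt.1 (Complex.abs_arg_lt_pi_div_two_iff.2 (Or.inl hre0))
  have hnorm : 0 < ‖p z‖ := norm_pos_iff.2 (by intro h; simp [h] at hre0)
  rw [← Complex.norm_mul_cos_arg, ← Complex.norm_mul_sin_arg] at h1 h2
  have h1' : 0 < ‖p z‖ * Real.sin (θ - (p z).arg) := by rw [Real.sin_sub]; linarith
  have h2' : 0 < ‖p z‖ * Real.sin (θ + (p z).arg) := by rw [Real.sin_add]; linarith
  have h1'' := pos_of_mul_pos_right h1' hnorm.le
  have h2'' := pos_of_mul_pos_right h2' hnorm.le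
  rw [abs_lt]
  constructor
  · by_contra h
    have := Real.sin_nonpos_of_nonpos_of_neg_pi_le (x := θ + (p z).arg) (by linarith) (by linarith)
    linarith
  · by_contra h
    have := Real.sin_nonpos_of_nonpos_of_neg_pi_le (x := θ - (p z).arg) (by linarith) (by linarith)
    linarith
end

section
/- Let n ≥ 1 be an integer. The function p(z) = 1 + k z^n with 0 < k ≤ (n² + 6n − 9)/(4n(4n + 3)) satisfies, with g(z) = 1 + z/3, the inequality Re(p(z) + g(z)·z·p'(z)) > (−n² + 6n + 9)/(12n) for all z ∈ 𝕌, and consequently |arg(p(z))| < π/4 for all z ∈ 𝕌. -/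
open Metric

/-- **Example 1.**  For `p(z) = 1 + k zⁿ` with `0 < k ≤ (n² + 6n - 9)/(4n(4n+3))` and
`g(z) = 1 + z/3`, one has `Re(p(z) + g(z) z p'(z)) > (-n² + 6n + 9)/(12n)` on the unit disk,
and consequently `|arg p(z)| < π/4` on the unit disk. -/
theorem example_strongly_caratheodory
    (n : ℕ) (hn : 1 ≤ n) (k : ℝ) (hk0 : 0 < k)
    (hk : k ≤ ((n : ℝ) ^ 2 + 6 * n - 9) / (4 * n * (4 * n + 3))) :
    (∀ z ∈ ball (0 : ℂ) 1,
      ((1 + (k : ℂ) * z ^ n) +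
        (1 + z / 3) * z * deriv (fun w : ℂ => 1 + (k : ℂ) * w ^ n) z).re >
        (-(n : ℝ) ^ 2 + 6 * n + 9) / (12 * n)) ∧
    (∀ z ∈ ball (0 : ℂ) 1, |(1 + (k : ℂ) * z ^ n).arg| < Real.pi / 4) := by
  have hn1 : (1 : ℝ) ≤ n := by exact_mod_cast hn
  have hden : (0 : ℝ) < 4 * n * (4 * n + 3) := by positivity
  have hk' : k * (4 * n * (4 * n + 3)) ≤ (n : ℝ) ^ 2 + 6 * n - 9 := (le_div_iff₀ hden).1 hk
  have hkhalf : k < 1 / 2 := by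
    refine lt_of_le_of_lt hk ?_
    rw [div_lt_iff₀ hden]
    nlinarith
  have hpow : ∀ z ∈ ball (0 : ℂ) 1, ‖z ^ n‖ < 1 := by
    intro z hz
    rw [norm_pow]
    exact pow_lt_one₀ (norm_nonneg _) (by simpa using hz) (by omega)
  refine ⟨fun z hz => ?_, fun z hz => ?_⟩
  · have hz1 : ‖z‖ < 1 := by simpa using hz
    have hd : deriv (fun w : ℂ => 1 + (k : ℂ) * w ^ n) z = k * (n * z ^ (n - 1)) := by
      simp
    have hzn : z * z ^ (n - 1) = z ^ n := by
      rw [← pow_succ']; congr 1; omega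
    have he : (1 + (k : ℂ) * z ^ n) +
        (1 + z / 3) * z * deriv (fun w : ℂ => 1 + (k : ℂ) * w ^ n) z
        = 1 + (k : ℂ) * (z ^ n * (1 + n + n * z / 3)) := by
      rw [hd, ← hzn]; ring
    rw [he]
    have h1 : ‖(1 : ℂ) + n + n * z / 3‖ ≤ (4 * n + 3) / 3 := by
      calc ‖(1 : ℂ) + n + n * z / 3‖ ≤ ‖(1 : ℂ)‖ + ‖(n : ℂ)‖ + ‖(n : ℂ) * z / 3‖ := norm_add₃_le
        _ = 1 + n + n * ‖z‖ / 3 := by simp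
        _ ≤ (4 * n + 3) / 3 := by nlinarith
    have h2 : ‖z ^ n * (1 + n + n * z / 3)‖ < (4 * n + 3) / 3 := by
      rw [norm_mul]
      have h3 : (0 : ℝ) < (4 * n + 3) / 3 := by positivity
      nlinarith [hpow z hz, norm_nonneg (z ^ n)]
    have h4 := (abs_le.1 (Complex.abs_re_le_norm (z ^ n * (1 + n + n * z / 3)))).1
    have h5 : (1 + (k : ℂ) * (z ^ n * (1 + n + n * z / 3))).re
        = 1 + k * (z ^ n * (1 + n + n * z / 3)).re := by
      rw [Complex.add_re, Complex.re_ofReal_mul, Complex.one_re]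
    rw [h5, gt_iff_lt, div_lt_iff₀ (by positivity)]
    have h6 : -((4 * n + 3) / 3) < (z ^ n * (1 + n + n * z / 3)).re := by linarith
    have h7 := mul_lt_mul_of_pos_left h6 (show 0 < k * (12 * n) by positivity)
    nlinarith
  · set w := 1 + (k : ℂ) * z ^ n with hw
    have h1 := hpow z hz
    have hr := abs_le.1 (Complex.abs_re_le_norm (z ^ n))
    have hi := abs_le.1 (Complex.abs_im_le_norm (z ^ n))
    have hre : w.re = 1 + k * (z ^ n).re := by
      rw [hw, Complex.add_re, Complex.re_ofReal_mul, Complex.one_re]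
    have him : w.im = k * (z ^ n).im := by
      rw [hw, Complex.add_im, Complex.im_ofReal_mul, Complex.one_im, zero_add]
    have hre2 : 1 / 2 < w.re := by rw [hre]; nlinarith
    have him2 : w.im < 1 / 2 := by rw [him]; nlinarith
    have him3 : -(1 / 2) < w.im := by rw [him]; nlinarith
    have hpos : 0 < w.re := by linarith
    have harg := abs_lt.1 (Complex.abs_arg_lt_pi_div_two_iff.2 (Or.inl hpos))
    have ht := Complex.tan_arg w
    have hpi := Real.pi_pos
    rw [← Real.arctan_tan harg.1 harg.2, ht, abs_lt, ← Real.arctan_one, ← Real.arctan_neg]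
    constructor
    · apply Real.arctan_strictMono
      rw [lt_div_iff₀ hpos]; linarith
    · apply Real.arctan_strictMono
      rw [div_lt_iff₀ hpos]; linarith
end
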